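/- Let μ1 be a probability measure on E with μ1 ≪ μ0, klDiv μ1 μ0 < ∞, and ∫ ‖x‖² dμ1 < ∞. Define m⋆ i = ∫ x i dμ1(x) and d⋆ i = (1/σ i) · ∫ (x i − m⋆ i)² dμ1(x), and assume d⋆ i > 0 for every i. Then for every m : Fin n → ℝ and every d : Fin n → ℝ with d i > 0 for all i, one has klDiv μ1 (N(m⋆, fun i => d⋆ i * σ i)) ≤ klDiv μ1 (N(m, fun i => d i * σ i)). That is, among all product Gaussian measures with covariance diagonal in the same basis as μ0, the Kullback–Leibler divergence from μ1 is minimised by matching the mean of μ1 and the directional variances of μ1. -/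

import Mathlib

open MeasureTheory ProbabilityTheory
open scoped ENNReal Classical

/-- The Kullback–Leibler divergence `∫ log (dμ/dν) dμ`, valued in `ℝ≥0∞`. -/
noncomputable def klDiv {α : Type*} [MeasurableSpace α] (μ ν : Measure α) : ℝ≥0∞ :=
  if μ ≪ ν ∧ Integrable (llr μ ν) μ then ENNReal.ofReal (∫ x, llr μ ν x ∂μ) else ∞

open scoped NNReal

/-- A product of nondegenerate real Gaussian measures has the product of the densities as its
density. -/
theorem pi_gaussianReal_eq_withDensity {ι : Type*} [Fintype ι] (a : ι → ℝ) {v : ι → ℝ≥0}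
    (hv : ∀ i, v i ≠ 0) :
    Measure.pi (fun i => gaussianReal (a i) (v i)) =
      (volume : Measure (ι → ℝ)).withDensity
        (fun x => ENNReal.ofReal (∏ i, gaussianPDFReal (a i) (v i) (x i))) := by
  refine Measure.pi_eq fun s hs => ?_
  rw [withDensity_apply _ (MeasurableSet.univ_pi hs), volume_pi, Measure.restrict_pi_pi,
    ← ofReal_integral_eq_lintegral_ofReal, integral_fintype_prod_eq_prod,
    ENNReal.ofReal_prod_of_nonneg]
  · exact Finset.prod_congr rfl fun i _ => (gaussianReal_apply_eq_integral _ (hv i) _).symm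
  · exact fun i _ => integral_nonneg fun x => gaussianPDFReal_nonneg _ _ _
  · exact Integrable.fintype_prod fun i => (integrable_gaussianPDFReal _ _).restrict
  · exact ae_of_all _ fun x => Finset.prod_nonneg fun i _ => gaussianPDFReal_nonneg _ _ _

theorem measurable_ofReal_prod_gaussianPDFReal {ι : Type*} [Fintype ι] (a : ι → ℝ) (v : ι → ℝ≥0) :
    Measurable fun x : ι → ℝ => ENNReal.ofReal (∏ i, gaussianPDFReal (a i) (v i) (x i)) :=
  (Finset.measurable_prod _ fun i _ =>
    (measurable_gaussianPDFReal (a i) (v i)).comp (measurable_pi_apply i)).ennreal_ofReal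

theorem log_gaussianPDFReal (a : ℝ) {v : ℝ≥0} (hv : v ≠ 0) (x : ℝ) :
    Real.log (gaussianPDFReal a v x) =
      -(Real.log (2 * Real.pi * v) / 2 + (x - a) ^ 2 / (2 * v)) := by
  have hv' : (0 : ℝ) < v := by positivity
  rw [gaussianPDFReal, Real.log_mul (by positivity) (Real.exp_pos _).ne', Real.log_exp,
    Real.log_inv, Real.log_sqrt (by positivity)]
  ring

theorem pi_gaussianReal_absolutelyContinuous {ι : Type*} [Fintype ι] (a : ι → ℝ) {v : ι → ℝ≥0}
    (hv : ∀ i, v i ≠ 0) :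
    Measure.pi (fun i => gaussianReal (a i) (v i)) ≪ (volume : Measure (ι → ℝ)) := by
  rw [pi_gaussianReal_eq_withDensity a hv]
  exact withDensity_absolutelyContinuous _ _

theorem absolutelyContinuous_pi_gaussianReal {ι : Type*} [Fintype ι] (a : ι → ℝ) {v : ι → ℝ≥0}
    (hv : ∀ i, v i ≠ 0) :
    (volume : Measure (ι → ℝ)) ≪ Measure.pi (fun i => gaussianReal (a i) (v i)) := by
  rw [pi_gaussianReal_eq_withDensity a hv]
  refine withDensity_absolutelyContinuous'
    (measurable_ofReal_prod_gaussianPDFReal a v).aemeasurable (ae_of_all _ fun x => ?_)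
  simpa using Finset.prod_pos fun i _ => gaussianPDFReal_pos (a i) (v i) (x i) (hv i)

/-- The log-likelihood ratio against a product Gaussian, expressed through the one against
Lebesgue measure. -/
theorem llr_pi_gaussianReal {ι : Type*} [Fintype ι] {μ : Measure (ι → ℝ)} [SigmaFinite μ]
    (hμ : μ ≪ volume) (a : ι → ℝ) {v : ι → ℝ≥0} (hv : ∀ i, v i ≠ 0) :
    llr μ (Measure.pi (fun i => gaussianReal (a i) (v i))) =ᵐ[μ] fun x => llr μ volume x +
      ∑ i, (Real.log (2 * Real.pi * v i) / 2 + (x i - a i) ^ 2 / (2 * v i)) := by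
  have hpos (x : ι → ℝ) : 0 < ∏ i, gaussianPDFReal (a i) (v i) (x i) :=
    Finset.prod_pos fun i _ => gaussianPDFReal_pos _ _ _ (hv i)
  have hlog (x : ι → ℝ) : Real.log (∏ i, gaussianPDFReal (a i) (v i) (x i)) =
      -∑ i, (Real.log (2 * Real.pi * v i) / 2 + (x i - a i) ^ 2 / (2 * v i)) := by
    rw [Real.log_prod fun i _ => (gaussianPDFReal_pos _ _ _ (hv i)).ne',
      ← Finset.sum_neg_distrib]
    exact Finset.sum_congr rfl fun i _ => log_gaussianPDFReal _ (hv i) _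
  have hdensity := Measure.rnDeriv_withDensity_right μ volume
    (measurable_ofReal_prod_gaussianPDFReal a v).aemeasurable
    (ae_of_all _ fun x => (ENNReal.ofReal_pos.2 (hpos x)).ne')
    (ae_of_all _ fun x => ENNReal.ofReal_ne_top)
  rw [pi_gaussianReal_eq_withDensity a hv]
  filter_upwards [hμ.ae_le hdensity, Measure.rnDeriv_pos hμ,
    hμ.ae_le (Measure.rnDeriv_lt_top μ volume)] with x hx hx_pos hx_top
  simp only [llr_def]
  rw [hx, ENNReal.toReal_mul, ENNReal.toReal_inv, ENNReal.toReal_ofReal (hpos x).le,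
    Real.log_mul (inv_ne_zero (hpos x).ne') (ENNReal.toReal_pos hx_pos.ne' hx_top.ne).ne',
    Real.log_inv, hlog, neg_neg, add_comm]

/-- For fixed variance `s` and squared bias `b`, the Gaussian cross-entropy is minimised at
variance `s` and zero bias. -/
theorem log_div_two_add_le {s t b : ℝ} (hs : 0 < s) (ht : 0 < t) (hb : 0 ≤ b) :
    Real.log (2 * Real.pi * s) / 2 + s / (2 * s) ≤
      Real.log (2 * Real.pi * t) / 2 + (s + b) / (2 * t) := by
  have hlog := Real.log_le_sub_one_of_pos (div_pos hs ht)
  rw [Real.log_div hs.ne' ht.ne'] at hlog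
  have hpi : 2 * Real.pi ≠ 0 := by positivity
  rw [Real.log_mul hpi hs.ne', Real.log_mul hpi ht.ne']
  have hself : s / (2 * s) = 1 / 2 := by field_simp
  have hsplit : (s + b) / (2 * t) = s / t / 2 + b / (2 * t) := by field_simp
  have hbias : 0 ≤ b / (2 * t) := by positivity
  linarith

theorem integrable_eval_sub_sq {ι : Type*} [Fintype ι] {μ : Measure (ι → ℝ)} [IsFiniteMeasure μ]
    (h : ∀ i, MemLp (fun x : ι → ℝ => x i) 2 μ) (i : ι) (c : ℝ) :
    Integrable (fun x => (x i - c) ^ 2) μ :=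
  ((h i).sub (memLp_const c)).integrable_sq

/-- The Kullback–Leibler divergence to a product Gaussian, for a measure with finite differential
entropy and finite second moments. -/
theorem klDiv_pi_gaussianReal {ι : Type*} [Fintype ι] {μ : Measure (ι → ℝ)}
    [IsProbabilityMeasure μ] (hμ : μ ≪ volume) (hllr : Integrable (llr μ volume) μ)
    (h : ∀ i, MemLp (fun x : ι → ℝ => x i) 2 μ) (a : ι → ℝ) {v : ι → ℝ≥0} (hv : ∀ i, v i ≠ 0) :
    klDiv μ (Measure.pi (fun i => gaussianReal (a i) (v i))) =
      ENNReal.ofReal (∫ x, llr μ volume x ∂μ +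
        ∑ i, (Real.log (2 * Real.pi * v i) / 2 + (∫ x, (x i - a i) ^ 2 ∂μ) / (2 * v i))) := by
  have hquad (i : ι) : Integrable (fun x : ι → ℝ => (x i - a i) ^ 2 / (2 * v i)) μ :=
    (integrable_eval_sub_sq h i (a i)).div_const _
  have hterm (i : ι) : Integrable (fun x : ι → ℝ =>
      Real.log (2 * Real.pi * v i) / 2 + (x i - a i) ^ 2 / (2 * v i)) μ :=
    (integrable_const _).add (hquad i)
  have hsum := integrable_finsetSum Finset.univ fun i _ => hterm i
  have hcongr := llr_pi_gaussianReal hμ a hv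
  rw [klDiv, if_pos ⟨hμ.trans (absolutelyContinuous_pi_gaussianReal a hv),
    (hllr.add hsum).congr hcongr.symm⟩, integral_congr_ae hcongr, integral_add hllr hsum,
    integral_finsetSum _ fun i _ => hterm i]
  congr 2
  refine Finset.sum_congr rfl fun i _ => ?_
  rw [integral_add (integrable_const _) (hquad i),
    integral_div (2 * (v i : ℝ)) fun x : ι → ℝ => (x i - a i) ^ 2]
  simp

/-- Bias–variance decomposition. -/
theorem integral_sub_sq_eq_add {Ω : Type*} [MeasurableSpace Ω] {μ : Measure Ω}
    [IsProbabilityMeasure μ] {f : Ω → ℝ} (hf : MemLp f 2 μ) (c : ℝ) :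
    ∫ x, (f x - c) ^ 2 ∂μ =
      ∫ x, (f x - ∫ y, f y ∂μ) ^ 2 ∂μ + ((∫ y, f y ∂μ) - c) ^ 2 := by
  have hint : Integrable f μ := hf.integrable (by norm_num)
  have expand (b : ℝ) : ∫ x, (f x - b) ^ 2 ∂μ =
      ∫ x, f x ^ 2 ∂μ - 2 * b * ∫ x, f x ∂μ + b ^ 2 := by
    have hrw : ∀ x, (f x - b) ^ 2 = f x ^ 2 - 2 * b * f x + b ^ 2 := fun x => by ring
    simp_rw [hrw]
    have hsub : Integrable (fun x => f x ^ 2 - 2 * b * f x) μ :=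
      hf.integrable_sq.sub (hint.const_mul _)
    rw [integral_add hsub (integrable_const _),
      integral_sub hf.integrable_sq (hint.const_mul _), integral_const_mul]
    simp
  rw [expand, expand]
  ring

/-- Among all product Gaussian measures with covariance diagonal in the same basis as
the prior `μ0 = N(0, σ)`, the Kullback–Leibler divergence from the target `μ1` is
minimised by matching the mean `m⋆` and the directional variances `d⋆ i * σ i` of `μ1`. -/
theorem klDiv_product_gaussian_minimizer
    (n : ℕ) (σ : Fin n → ℝ) (hσ : ∀ i, 0 < σ i)
    (μ1 : Measure (Fin n → ℝ)) [IsProbabilityMeasure μ1]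
    (hac : μ1 ≪ Measure.pi (fun i => gaussianReal 0 (σ i).toNNReal))
    (hkl : klDiv μ1 (Measure.pi (fun i => gaussianReal 0 (σ i).toNNReal)) < ∞)
    (hmom : Integrable (fun x => ‖x‖ ^ 2) μ1)
    (mstar dstar : Fin n → ℝ)
    (hmstar : ∀ i, mstar i = ∫ x, x i ∂μ1)
    (hdstar : ∀ i, dstar i = (1 / σ i) * ∫ x, (x i - mstar i) ^ 2 ∂μ1)
    (hdstar_pos : ∀ i, 0 < dstar i)
    (m d : Fin n → ℝ) (hd : ∀ i, 0 < d i) :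
    klDiv μ1 (Measure.pi (fun i => gaussianReal (mstar i) (dstar i * σ i).toNNReal))
      ≤ klDiv μ1 (Measure.pi (fun i => gaussianReal (m i) (d i * σ i).toNNReal)) := by
  have hprior (i : Fin n) : (σ i).toNNReal ≠ 0 := by simpa using hσ i
  have hμ : μ1 ≪ volume := hac.trans (pi_gaussianReal_absolutelyContinuous _ hprior)
  have hL2 (i : Fin n) : MemLp (fun x : Fin n → ℝ => x i) 2 μ1 := by
    rw [memLp_two_iff_integrable_sq (measurable_pi_apply i).aestronglyMeasurable]
    refine hmom.mono' ((measurable_pi_apply i).pow_const 2).aestronglyMeasurable (ae_of_all _ fun x => ?_)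
    rw [norm_pow]
    gcongr
    exact norm_le_pi_norm x i
  have hllr : Integrable (llr μ1 volume) μ1 := by
    have hprior_llr : Integrable
        (llr μ1 (Measure.pi (fun i => gaussianReal 0 (σ i).toNNReal))) μ1 := by
      by_contra hnot
      simp [klDiv, hnot] at hkl
    have hsum := integrable_finsetSum (μ := μ1) Finset.univ fun i (_ : i ∈ Finset.univ) =>
      (integrable_const (Real.log (2 * Real.pi * (σ i).toNNReal) / 2)).add
        ((integrable_eval_sub_sq hL2 i 0).div_const (2 * ((σ i).toNNReal : ℝ)))
    refine (hprior_llr.sub hsum).congr ?_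
    filter_upwards [llr_pi_gaussianReal hμ (fun _ => 0) hprior] with x hx
    simp [hx]
  have hs (i : Fin n) : 0 < dstar i * σ i := mul_pos (hdstar_pos i) (hσ i)
  have ht (i : Fin n) : 0 < d i * σ i := mul_pos (hd i) (hσ i)
  have hvar (i : Fin n) : ∫ x, (x i - mstar i) ^ 2 ∂μ1 = dstar i * σ i := by
    rw [hdstar i]
    field_simp [(hσ i).ne']
  rw [klDiv_pi_gaussianReal hμ hllr hL2 mstar fun i => by simpa using hs i,
    klDiv_pi_gaussianReal hμ hllr hL2 m fun i => by simpa using ht i]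
  refine ENNReal.ofReal_le_ofReal (add_le_add_right (Finset.sum_le_sum fun i _ => ?_) _)
  rw [Real.coe_toNNReal _ (hs i).le, Real.coe_toNNReal _ (ht i).le,
    integral_sub_sq_eq_add (hL2 i) (m i), ← hmstar i, hvar i]
  exact log_div_two_add_le (hs i) (ht i) (sq_nonneg _)
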